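/- Let D_s : ℝ × ℝ^m → ℝ × ℝ^m be the dilatation D_s(t, x) = (st, x). For every real s ≥ 0 and all convex bodies Δ₀, …, Δ_m ⊂ ℝ × ℝ^m, MS(D_s Δ₀, …, D_s Δ_m) = s · MS(Δ₀, …, Δ_m). -/

import Mathlib

open MeasureTheory

/-- The shadow volume of a convex body `B ⊂ ℝ × ℝ^m`. -/
noncomputable def shadowVolume (m : ℕ) (B : Set (ℝ × (Fin m → ℝ))) : ℝ :=
  ∫ a in Prod.snd '' B, sSup {t : ℝ | (t, a) ∈ B}

/-- The dilatation `D_s(t, x) = (s·t, x)` of `ℝ × ℝ^m` along the first coordinate,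
as a linear map. -/
noncomputable def dilMap (m : ℕ) (s : ℝ) : (ℝ × (Fin m → ℝ)) →ₗ[ℝ] (ℝ × (Fin m → ℝ)) :=
  LinearMap.prodMap (s • LinearMap.id) LinearMap.id

/-- The image of a convex body `Δ ⊂ ℝ × ℝ^m` under the dilatation `D_s(t, x) = (s·t, x)`. -/
noncomputable def dilateBody (m : ℕ) (s : ℝ) (Δ : ConvexBody (ℝ × (Fin m → ℝ))) :
    ConvexBody (ℝ × (Fin m → ℝ)) where
  carrier := dilMap m s '' (Δ : Set (ℝ × (Fin m → ℝ)))
  convex' := Δ.convex.linear_image (dilMap m s)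
  isCompact' := Δ.isCompact.image (dilMap m s).continuous_of_finiteDimensional
  nonempty' := Δ.nonempty.image _

open scoped Pointwise

/-- A symmetric map on `n`-tuples in an additive commutative monoid which is additive in each
argument and vanishes on the diagonal is zero. -/
theorem MultilinearMap.eq_zero_of_symm_of_diag {ι M R : Type*} [Fintype ι] [DecidableEq ι]
    [AddCommMonoid M] [Ring R] [IsDomain R] [CharZero R]
    (f : MultilinearMap ℕ (fun _ : ι => M) R)
    (symm : ∀ (x : ι → M) (σ : Equiv.Perm ι), f (x ∘ σ) = f x)
    (diag : ∀ y : M, f (fun _ => y) = 0) (x : ι → M) : f x = 0 := by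
  have alternating_sum (g : ι → ι) :
      ∑ S : Finset ι, (if ∀ i, g i ∈ S then (-1 : ℤ) ^ Sᶜ.card else 0)
        = if Function.Bijective g then 1 else 0 := by
    rw [← Equiv.sum_comp (⟨compl, compl, compl_compl, compl_compl⟩ : Finset ι ≃ Finset ι),
      ← Finset.sum_filter]
    have filter_eq : Finset.univ.filter (fun S : Finset ι => ∀ i, g i ∈ Sᶜ)
        = (Finset.univ.image g)ᶜ.powerset := by
      ext S
      simp only [Finset.mem_filter, Finset.mem_univ, true_and, Finset.mem_compl,
        Finset.mem_powerset, Finset.subset_iff, Finset.mem_image]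
      exact ⟨fun h a ha ⟨i, hi⟩ => h i (hi ▸ ha), fun h i hi => h hi ⟨i, rfl⟩⟩
    simp only [Equiv.coe_fn_mk, compl_compl, filter_eq]
    rw [Finset.sum_powerset_neg_one_pow_card]
    simp only [Finset.compl_eq_empty_iff, ← Finite.surjective_iff_bijective]
    congr 1
    simp [Finset.eq_univ_iff_forall, Function.Surjective]
  have expand : ∑ S : Finset ι, (-1 : ℤ) ^ Sᶜ.card • f (fun _ => ∑ i ∈ S, x i)
      = ((Finset.univ.filter fun g : ι → ι => Function.Bijective g).card : R) * f x := by
    have term_eq (S : Finset ι) : (-1 : ℤ) ^ Sᶜ.card • f (fun _ => ∑ i ∈ S, x i)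
        = ∑ g : ι → ι, (if ∀ i, g i ∈ S then (-1 : ℤ) ^ Sᶜ.card else 0) • f (x ∘ g) := by
      rw [f.map_sum_finset (fun _ j => x j) (fun _ => S), Finset.smul_sum]
      simp only [ite_smul, zero_smul, ← Finset.sum_filter]
      refine Finset.sum_congr ?_ fun _ _ => rfl
      ext g
      simp
    simp only [term_eq]
    rw [Finset.sum_comm]
    simp only [← Finset.sum_smul, alternating_sum]
    simp only [ite_smul, zero_smul, one_smul]
    rw [← Finset.sum_filter, ← nsmul_eq_mul, ← Finset.sum_const]
    refine Finset.sum_congr rfl fun g hg => ?_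
    exact symm x (Equiv.ofBijective g (Finset.mem_filter.mp hg).2)
  simp only [diag, smul_zero, Finset.sum_const_zero] at expand
  refine (mul_eq_zero.mp expand.symm).resolve_left ?_
  rw [← ne_eq, Nat.cast_ne_zero, Finset.card_ne_zero]
  exact ⟨id, by simp⟩

/-- A map on tuples which is additive in each argument, as an `ℕ`-multilinear map. -/
def MultilinearMap.ofMapUpdateAdd {ι M G : Type*} [dec : DecidableEq ι]
    [AddCommMonoid M] [AddCommGroup G] (f : (ι → M) → G)
    (hf : ∀ (x : ι → M) (i : ι) (a b : M), f (Function.update x i (a + b))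
      = f (Function.update x i a) + f (Function.update x i b)) :
    MultilinearMap ℕ (fun _ : ι => M) G where
  toFun := f
  map_update_add' {inst} x i a b := by
    obtain rfl : inst = dec := Subsingleton.elim _ _
    exact hf x i a b
  map_update_smul' {inst} x i c a := by
    obtain rfl : inst = dec := Subsingleton.elim _ _
    exact map_nsmul (AddMonoidHom.mk' (fun a => f (Function.update x i a)) (hf x i)) c a

theorem dilateBody_add (m : ℕ) (s : ℝ) (K K' : ConvexBody (ℝ × (Fin m → ℝ))) :
    dilateBody m s (K + K') = dilateBody m s K + dilateBody m s K' :=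
  SetLike.coe_injective (Set.image_add (dilMap m s))

theorem shadowVolume_dilateBody (m : ℕ) {s : ℝ} (hs : 0 ≤ s)
    (B : ConvexBody (ℝ × (Fin m → ℝ))) :
    shadowVolume m (dilateBody m s B : Set (ℝ × (Fin m → ℝ)))
      = s * shadowVolume m (B : Set (ℝ × (Fin m → ℝ))) := by
  have coe_eq : (dilateBody m s B : Set (ℝ × (Fin m → ℝ)))
      = dilMap m s '' (B : Set (ℝ × (Fin m → ℝ))) := rfl
  have proj_eq : Prod.snd '' (dilMap m s '' (B : Set (ℝ × (Fin m → ℝ))))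
      = Prod.snd '' (B : Set (ℝ × (Fin m → ℝ))) := by
    rw [Set.image_image]
    rfl
  have fiber_eq (a : Fin m → ℝ) : {t : ℝ | (t, a) ∈ dilMap m s '' (B : Set (ℝ × (Fin m → ℝ)))}
      = s • {t : ℝ | (t, a) ∈ B} := by
    ext t
    simp [Set.mem_smul_set, dilMap]
  simp only [shadowVolume, coe_eq, proj_eq, fiber_eq, Real.sSup_smul_of_nonneg hs, smul_eq_mul]
  exact integral_const_mul s _

/-- For `s ≥ 0`, `MS(D_s Δ₀, …, D_s Δ_m) = s · MS(Δ₀, …, Δ_m)`. -/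
theorem mixed_shadow_volume_dilate (m : ℕ)
    (MS : (Fin (m + 1) → ConvexBody (ℝ × (Fin m → ℝ))) → ℝ)
    (MS_symm : ∀ (Δ : Fin (m + 1) → ConvexBody (ℝ × (Fin m → ℝ)))
      (σ : Equiv.Perm (Fin (m + 1))), MS (Δ ∘ σ) = MS Δ)
    (MS_add : ∀ (Δ : Fin (m + 1) → ConvexBody (ℝ × (Fin m → ℝ))) (i : Fin (m + 1))
      (K K' : ConvexBody (ℝ × (Fin m → ℝ))),
      MS (Function.update Δ i (K + K'))
        = MS (Function.update Δ i K) + MS (Function.update Δ i K'))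
    (MS_diag : ∀ B : ConvexBody (ℝ × (Fin m → ℝ)),
      MS (fun _ => B) = shadowVolume m (B : Set (ℝ × (Fin m → ℝ))))
    (s : ℝ) (hs : 0 ≤ s) (Δ : Fin (m + 1) → ConvexBody (ℝ × (Fin m → ℝ))) :
    MS (fun i => dilateBody m s (Δ i)) = s * MS Δ := by
  let F : MultilinearMap ℕ (fun _ : Fin (m + 1) => ConvexBody (ℝ × (Fin m → ℝ))) ℝ :=
    .ofMapUpdateAdd (fun Δ => MS (fun i => dilateBody m s (Δ i)) - s * MS Δ) <| by
      intro Δ i K K'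
      have comp_update (L : ConvexBody (ℝ × (Fin m → ℝ))) :
          (fun j => dilateBody m s (Function.update Δ i L j))
            = Function.update (fun j => dilateBody m s (Δ j)) i (dilateBody m s L) :=
        Function.comp_update (dilateBody m s) Δ i L
      simp only [comp_update, dilateBody_add, MS_add]
      ring
  refine sub_eq_zero.mp (F.eq_zero_of_symm_of_diag (fun Δ σ => ?_) (fun B => ?_) Δ)
  · exact congrArg₂ (fun a b => a - s * b)
      (MS_symm (fun i => dilateBody m s (Δ i)) σ) (MS_symm Δ σ)
  · exact sub_eq_zero.mpr (by rw [MS_diag, MS_diag, shadowVolume_dilateBody m hs])
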